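/- There exists a pair (α, β) ∈ ℝ² of irrational numbers and a constant c > 1/4 such that q·max(|q·α - p₁|², |q·β - p₂|²) ≥ c for all integers p₁, p₂ and all sufficiently large integers q ≥ 1. -/

import Mathlib

/-- The norm of `A + B θ + C θ²`, where `θ` is a root of `X³ + X² - 2 X - 1`. -/
def cubicNorm {R : Type*} [CommRing R] (A B C : R) : R :=
  A ^ 3 - A ^ 2 * B + 5 * A ^ 2 * C - 2 * A * B ^ 2 - A * B * C + 6 * A * C ^ 2 + B ^ 3
    - B ^ 2 * C - 2 * B * C ^ 2 + C ^ 3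

/-- The product of the two other conjugates of `A + B θ + C θ²`. -/
def cubicCofactor {R : Type*} [CommRing R] (t A B C : R) : R :=
  A ^ 2 - A * B * (1 + t) + A * C * (5 - t ^ 2) + B ^ 2 * (t ^ 2 + t - 2) - B * C * (t ^ 2 + t - 1)
    + C ^ 2 * (5 - t - 2 * t ^ 2)

lemma cubicNorm_eq_mul_cofactor {R : Type*} [CommRing R] {t : R}
    (ht : t ^ 3 + t ^ 2 - 2 * t - 1 = 0) (A B C : R) :
    cubicNorm A B C = (A + B * t + C * t ^ 2) * cubicCofactor t A B C := by
  unfold cubicNorm cubicCofactor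
  grind

lemma even_of_even_cubicNorm {A B C : ℤ} (h : 2 ∣ cubicNorm A B C) :
    2 ∣ A ∧ 2 ∣ B ∧ 2 ∣ C := by
  have key : ∀ x y z : ZMod 2, cubicNorm x y z = 0 → x = 0 ∧ y = 0 ∧ z = 0 := by
    unfold cubicNorm
    decide
  have h2 : ((cubicNorm A B C : ℤ) : ZMod 2) = 0 :=
    (ZMod.intCast_zmod_eq_zero_iff_dvd _ 2).2 (by exact_mod_cast h)
  have h3 := key A B C (by
    rw [← h2]
    simp [cubicNorm])
  simpa only [ZMod.intCast_zmod_eq_zero_iff_dvd, Nat.cast_ofNat] using h3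

lemma pow_two_dvd_of_cubicNorm_eq_zero (n : ℕ) {A B C : ℤ} (h : cubicNorm A B C = 0) :
    (2 : ℤ) ^ n ∣ A ∧ (2 : ℤ) ^ n ∣ B ∧ (2 : ℤ) ^ n ∣ C := by
  induction n generalizing A B C with
  | zero => simp
  | succ n ih =>
    obtain ⟨⟨a, rfl⟩, ⟨b, rfl⟩, ⟨c, rfl⟩⟩ := even_of_even_cubicNorm (h ▸ dvd_zero 2)
    have h8 : cubicNorm a b c = 0 := by
      have : 8 * cubicNorm a b c = 0 := by
        rw [← h]
        unfold cubicNorm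
        ring
      lia
    obtain ⟨ha, hb, hc⟩ := ih h8
    rw [pow_succ']
    exact ⟨mul_dvd_mul_left 2 ha, mul_dvd_mul_left 2 hb, mul_dvd_mul_left 2 hc⟩

lemma eq_zero_of_forall_two_pow_dvd {a : ℤ} (h : ∀ n : ℕ, (2 : ℤ) ^ n ∣ a) : a = 0 := by
  refine Int.eq_zero_of_abs_lt_dvd (h a.natAbs) ?_
  rw [Int.abs_eq_natAbs]
  exact_mod_cast Nat.lt_two_pow_self

lemma eq_zero_of_cubicNorm_eq_zero {A B C : ℤ} (h : cubicNorm A B C = 0) :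
    A = 0 ∧ B = 0 ∧ C = 0 :=
  ⟨eq_zero_of_forall_two_pow_dvd fun n => (pow_two_dvd_of_cubicNorm_eq_zero n h).1,
    eq_zero_of_forall_two_pow_dvd fun n => (pow_two_dvd_of_cubicNorm_eq_zero n h).2.1,
    eq_zero_of_forall_two_pow_dvd fun n => (pow_two_dvd_of_cubicNorm_eq_zero n h).2.2⟩

lemma cubicNorm_intCast {R : Type*} [CommRing R] (A B C : ℤ) :
    cubicNorm (A : R) B C = ((cubicNorm A B C : ℤ) : R) := by
  simp [cubicNorm]

lemma eq_zero_of_add_mul_eq_zero {t : ℝ} (ht : t ^ 3 + t ^ 2 - 2 * t - 1 = 0) {A B C : ℤ}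
    (h : (A : ℝ) + B * t + C * t ^ 2 = 0) : A = 0 ∧ B = 0 ∧ C = 0 := by
  apply eq_zero_of_cubicNorm_eq_zero
  have := cubicNorm_eq_mul_cofactor ht (A : ℝ) B C
  rw [h, zero_mul, cubicNorm_intCast] at this
  exact_mod_cast this

lemma irrational_int_combination {t : ℝ} (ht : t ^ 3 + t ^ 2 - 2 * t - 1 = 0) {m n : ℤ}
    (hm : m ≠ 0) : Irrational (m * t + n * t ^ 2) := by
  rintro ⟨r, hr⟩
  have hd : (r.den : ℝ) ≠ 0 := by exact_mod_cast r.den_nz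
  rw [Rat.cast_def, div_eq_iff hd] at hr
  have h := eq_zero_of_add_mul_eq_zero ht (A := -r.num) (B := m * r.den) (C := n * r.den) (by
    push_cast
    rw [hr]
    ring)
  exact (mul_ne_zero hm (by exact_mod_cast r.den_nz)) h.2.1

/-- The binary form governing the approximation errors `x = q θ - P₁` and `y = q θ² - P₂`. -/
def errorForm {R : Type*} [CommRing R] (t x y : R) : R :=
  y ^ 2 + (1 - t) * x * y + (t ^ 2 - 2) * x ^ 2

lemma cubicNorm_eq_mul_errorForm {R : Type*} [CommRing R] {t : R}
    (ht : t ^ 3 + t ^ 2 - 2 * t - 1 = 0) (q P₁ P₂ : R) :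
    cubicNorm (P₂ + P₁ - 2 * q) (P₁ + q) q =
      ((3 * t ^ 2 + 2 * t - 2) * q - (q * t ^ 2 - P₂) - (q * t - P₁) * (1 + t)) *
        errorForm t (q * t - P₁) (q * t ^ 2 - P₂) := by
  rw [cubicNorm_eq_mul_cofactor ht]
  unfold cubicCofactor errorForm
  grind

lemma exists_cubic_root :
    ∃ t : ℝ, t ^ 3 + t ^ 2 - 2 * t - 1 = 0 ∧
      1.24697960371746706105000976800847 ≤ t ∧ t ≤ 1.24697960371746706105000976800848 := by
  have hc : ContinuousOn (fun t : ℝ => t ^ 3 + t ^ 2 - 2 * t - 1)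
      (Set.Icc 1.24697960371746706105000976800847 1.24697960371746706105000976800848) := by
    fun_prop
  obtain ⟨t, ht, h⟩ := intermediate_value_Icc (by norm_num) hc (show (0 : ℝ) ∈ _ by
    constructor <;> norm_num)
  exact ⟨t, h, ht⟩

lemma errorForm_change_basis {t : ℝ} (ht : t ^ 3 + t ^ 2 - 2 * t - 1 = 0) (x y : ℝ) :
    (3 * t ^ 2 + 2 * t - 2) *
        errorForm t (444748349 * x + 422175922 * y) (356660484 * x + 338558803 * y) =
      (818315654253280631 * t ^ 2 - 656238202945530723 * t - 454130926942255689) * x ^ 2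
      + (1553566940037868336 * t ^ 2 - 1245863954315219050 * t - 862164607116108415) * (x * y)
      + (737359179380793807 * t ^ 2 - 591316150787547366 * t - 409203472866642196) * y ^ 2 := by
  unfold errorForm
  grind

lemma abs_form_le {a b c x y m : ℝ} (ha : 3.11 ≤ a) (ha' : a ≤ 3.12) (hb : |b| ≤ 1.09)
    (hc : -3.84 ≤ c) (hc' : c ≤ -3.83) (hx : |x| ≤ m) (hy : |y| ≤ m) :
    |a * x ^ 2 + b * (x * y) + c * y ^ 2| ≤ 3.94 * m ^ 2 := by
  have hx2 : x ^ 2 ≤ m ^ 2 := sq_le_sq' (abs_le.1 hx).1 (abs_le.1 hx).2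
  have hy2 : y ^ 2 ≤ m ^ 2 := sq_le_sq' (abs_le.1 hy).1 (abs_le.1 hy).2
  have hbxy : |b * (x * y)| ≤ 1.09 * (|x| * |y|) := by
    rw [abs_mul, abs_mul]
    gcongr
  obtain ⟨h1, h2⟩ := abs_le.1 hbxy
  have e1 : |x| ^ 2 = x ^ 2 := sq_abs x
  have e2 : |y| ^ 2 = y ^ 2 := sq_abs y
  have hax := mul_le_mul_of_nonneg_right ha (sq_nonneg x)
  have hax' := mul_le_mul_of_nonneg_right ha' (sq_nonneg x)
  have hcy := mul_le_mul_of_nonneg_right hc (sq_nonneg y)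
  have hcy' := mul_le_mul_of_nonneg_right hc' (sq_nonneg y)
  rw [abs_le]
  constructor
  · nlinarith [sq_nonneg (6.22 * |x| - 1.09 * |y|)]
  · nlinarith [sq_nonneg (7.66 * |y| - 1.09 * |x|)]

theorem stmt_15 :
    ∃ α β : ℝ, Irrational α ∧ Irrational β ∧ ∃ c : ℝ, 1 / 4 < c ∧ ∃ q₀ : ℤ,
      ∀ q : ℤ, q₀ ≤ q → 1 ≤ q → ∀ p₁ p₂ : ℤ,
        c ≤ (q : ℝ) * max (|(q : ℝ) * α - p₁| ^ 2) (|(q : ℝ) * β - p₂| ^ 2) := by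
  obtain ⟨t, ht, hlo, hhi⟩ := exists_cubic_root
  have hlo2 : (1.24697960371746706105000976800847 : ℝ) ^ 2 ≤ t ^ 2 := by gcongr
  have hhi2 : t ^ 2 ≤ (1.24697960371746706105000976800848 : ℝ) ^ 2 := by gcongr
  norm_num1 at hlo hhi hlo2 hhi2
  refine ⟨((-338558803 : ℤ) : ℝ) * t + ((422175922 : ℤ) : ℝ) * t ^ 2,
    ((356660484 : ℤ) : ℝ) * t + ((-444748349 : ℤ) : ℝ) * t ^ 2,
    irrational_int_combination ht (by norm_num), irrational_int_combination ht (by norm_num),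
    0.252, by norm_num, 10 ^ 14, fun q hq₀ hq p₁ p₂ => ?_⟩
  set x : ℝ := q * (((-338558803 : ℤ) : ℝ) * t + ((422175922 : ℤ) : ℝ) * t ^ 2) - p₁ with hx
  set y : ℝ := q * (((356660484 : ℤ) : ℝ) * t + ((-444748349 : ℤ) : ℝ) * t ^ 2) - p₂ with hy
  set m : ℝ := max |x| |y| with hm
  have hxm : |x| ≤ m := le_max_left _ _
  have hym : |y| ≤ m := le_max_right _ _
  have hm0 : 0 ≤ m := (abs_nonneg x).trans hxm
  have hmax : max (|x| ^ 2) (|y| ^ 2) = m ^ 2 := by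
    rcases le_total |x| |y| with h | h
    · rw [hm, max_eq_right h, max_eq_right (by gcongr)]
    · rw [hm, max_eq_left h, max_eq_left (by gcongr)]
  rw [hmax]
  have hq₀' : (10 : ℝ) ^ 14 ≤ q := by exact_mod_cast hq₀
  by_contra! hlt
  have hqm : (10 : ℝ) ^ 14 * m ^ 2 ≤ 0.252 :=
    (mul_le_mul_of_nonneg_right hq₀' (sq_nonneg m)).trans hlt.le
  have hm1 : m ≤ 1 := by nlinarith only [hqm, hm0]
  set P₁ : ℤ := 444748349 * p₁ + 422175922 * p₂ with hP₁
  set P₂ : ℤ := 356660484 * p₁ + 338558803 * p₂ with hP₂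
  have he₁ : (q : ℝ) * t - P₁ = 444748349 * x + 422175922 * y := by
    rw [hx, hy, hP₁]; push_cast; ring
  have he₂ : (q : ℝ) * t ^ 2 - P₂ = 356660484 * x + 338558803 * y := by
    rw [hx, hy, hP₂]; push_cast; ring
  have hN : 1 ≤ |cubicNorm ((P₂ : ℝ) + P₁ - 2 * q) (P₁ + q) q| := by
    have hne : cubicNorm (P₂ + P₁ - 2 * q) (P₁ + q) q ≠ 0 := fun h => by
      have := (eq_zero_of_cubicNorm_eq_zero h).2.2
      lia
    have := Int.one_le_abs hne
    have hcast := cubicNorm_intCast (R := ℝ) (P₂ + P₁ - 2 * q) (P₁ + q) q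
    push_cast at hcast
    rw [hcast]
    exact_mod_cast this
  rw [cubicNorm_eq_mul_errorForm ht, he₁, he₂, abs_mul] at hN
  have hform := errorForm_change_basis ht x y
  set E := errorForm t (444748349 * x + 422175922 * y) (356660484 * x + 338558803 * y)
  have hE : |(3 * t ^ 2 + 2 * t - 2) * E| ≤ 3.94 * m ^ 2 := by
    rw [hform]
    apply abs_form_le _ _ _ _ _ hxm hym
    · linarith
    · linarith
    · rw [abs_le]; constructor <;> linarith
    · linarith
    · linarith
  have hd : 5 ≤ 3 * t ^ 2 + 2 * t - 2 := by linarith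
  have hd' : 3 * t ^ 2 + 2 * t - 2 ≤ 6 := by linarith
  set d := 3 * t ^ 2 + 2 * t - 2
  clear_value d E x y m
  have hL : |d * q - (356660484 * x + 338558803 * y)
      - (444748349 * x + 422175922 * y) * (1 + t)| ≤ d * q + 10 ^ 10 := by
    obtain ⟨hx1, hx2⟩ := abs_le.1 (hxm.trans hm1)
    obtain ⟨hy1, hy2⟩ := abs_le.1 (hym.trans hm1)
    have hdq : 0 ≤ d * q := by positivity
    have hxt : |x * t| ≤ 1 * 2 := by
      rw [abs_mul]
      gcongr
      · exact hxm.trans hm1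
      · rw [abs_le]; constructor <;> linarith
    have hyt : |y * t| ≤ 1 * 2 := by
      rw [abs_mul]
      gcongr
      · exact hym.trans hm1
      · rw [abs_le]; constructor <;> linarith
    obtain ⟨hxt1, hxt2⟩ := abs_le.1 hxt
    obtain ⟨hyt1, hyt2⟩ := abs_le.1 hyt
    rw [abs_le]
    constructor <;> linarith
  have hprod : d ≤ (d * q + 10 ^ 10) * (3.94 * m ^ 2) := by
    rw [abs_mul, abs_of_pos (by linarith : 0 < d)] at hE
    calc d ≤ d * (_ * |E|) := le_mul_of_one_le_right (by linarith) hN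
      _ = |d * q - (356660484 * x + 338558803 * y)
          - (444748349 * x + 422175922 * y) * (1 + t)| * (d * |E|) := by ring
      _ ≤ (d * q + 10 ^ 10) * (3.94 * m ^ 2) := by gcongr
  have hdqm := mul_le_mul_of_nonneg_left hlt.le (by linarith : 0 ≤ d)
  linarith
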